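/- Let x⁰, x¹, … be a PPA sequence for min_{x∈Ω} q(x) with inf_{x∈Ω} q(x) > −∞, equipped with a recession decomposition x^k = y^k + α^k d^k (y^k ∈ Ω̄, α^k ≥ 0, d^k ∈ Ω₁^∞). Let d ∈ Ω₁^∞ be such that there is a subsequence (k_i) with α^{k_i} → ∞ and d^{k_i} → d. Then there exists ε_d > 0 such that for every k ≥ 1 with dist(d^k, d) ≤ ε_d one has α^k dᵀd^k ≤ α^{k−1} dᵀd^{k−1}. (Theorem 3.4.) -/

import Mathlib

open Matrix Filter Topology

/-- Euclidean norm of a finitely-indexed real vector. -/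
noncomputable def vnorm {ι : Type*} [Fintype ι] (v : ι → ℝ) : ℝ :=
  Real.sqrt (v ⬝ᵥ v)

/-- Membership in the (possibly unbounded) box `Ω = {x | l ≤ x ≤ u}`,
with extended-real bounds. -/
def inBox {n : ℕ} (l u : Fin n → EReal) (x : Fin n → ℝ) : Prop :=
  ∀ j, l j ≤ (x j : EReal) ∧ (x j : EReal) ≤ u j

/-- `d` is a recession direction of the box `Ω`. -/
def recDir {n : ℕ} (l u : Fin n → EReal) (d : Fin n → ℝ) : Prop :=
  ∀ x, inBox l u x → ∀ α : ℝ, 0 ≤ α → inBox l u (x + α • d)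

/-- The quadratic objective `q(x) = ½ xᵀQx + rᵀx`. -/
noncomputable def qf {n : ℕ} (Q : Matrix (Fin n) (Fin n) ℝ) (r : Fin n → ℝ)
    (x : Fin n → ℝ) : ℝ :=
  (1 / 2) * (x ⬝ᵥ Q *ᵥ x) + r ⬝ᵥ x

/-- Membership in the set `Ω̄ = Ω̄₁ × ⋯ × Ω̄ₙ` used for the recession
decomposition `x = y + α d`. -/
def inOmegaBar {n : ℕ} (l u : Fin n → EReal) (y : Fin n → ℝ) : Prop :=
  ∀ j, (l j ≠ ⊥ ∧ u j = ⊤ → (y j : EReal) = l j) ∧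
    (l j = ⊥ ∧ u j ≠ ⊤ → (y j : EReal) = u j) ∧
    (l j = ⊥ ∧ u j = ⊤ → y j = 0) ∧
    (l j ≠ ⊥ ∧ u j ≠ ⊤ → l j ≤ (y j : EReal) ∧ (y j : EReal) ≤ u j)

lemma aux_symm {n : ℕ} {Q : Matrix (Fin n) (Fin n) ℝ} (hQ : Q.IsSymm) (a b : Fin n → ℝ) :
    a ⬝ᵥ Q *ᵥ b = b ⬝ᵥ Q *ᵥ a := by
  rw [Matrix.dotProduct_mulVec, dotProduct_comm, ← Matrix.mulVec_transpose, hQ.eq]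

lemma aux_vnorm {n : ℕ} (v : Fin n → ℝ) : vnorm v ^ 2 = v ⬝ᵥ v := by
  unfold vnorm
  exact Real.sq_sqrt (Finset.sum_nonneg fun i _ => mul_self_nonneg _)

lemma aux_norm_le {n : ℕ} (v : Fin n → ℝ) : ‖v‖ ^ 2 ≤ v ⬝ᵥ v := by
  have h0 : 0 ≤ v ⬝ᵥ v := Finset.sum_nonneg fun i _ => mul_self_nonneg _
  have : ‖v‖ ≤ Real.sqrt (v ⬝ᵥ v) := by
    rw [pi_norm_le_iff_of_nonneg (Real.sqrt_nonneg _)]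
    intro i
    rw [Real.norm_eq_abs]
    apply Real.abs_le_sqrt
    rw [sq]
    exact Finset.single_le_sum (f := fun i => v i * v i) (fun i _ => mul_self_nonneg _)
      (Finset.mem_univ i)
  calc ‖v‖ ^ 2 ≤ Real.sqrt (v ⬝ᵥ v) ^ 2 := by gcongr
    _ = _ := Real.sq_sqrt h0

lemma aux_dot_le {n : ℕ} (v w : Fin n → ℝ) : |v ⬝ᵥ w| ≤ n * (‖v‖ * ‖w‖) := by
  calc |v ⬝ᵥ w| ≤ ∑ i, |v i * w i| := Finset.abs_sum_le_sum_abs _ _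
    _ ≤ ∑ i : Fin n, ‖v‖ * ‖w‖ := by
        apply Finset.sum_le_sum
        intro i _
        rw [abs_mul]
        gcongr
        · exact norm_le_pi_norm v i
        · exact norm_le_pi_norm w i
    _ = _ := by simp

lemma aux_qf {n : ℕ} {Q : Matrix (Fin n) (Fin n) ℝ} (hQ : Q.IsSymm) (r x v : Fin n → ℝ) :
    qf Q r (x + v) = qf Q r x + v ⬝ᵥ (Q *ᵥ x + r) + 1 / 2 * (v ⬝ᵥ Q *ᵥ v) := by
  unfold qf
  simp only [mulVec_add, dotProduct_add, add_dotProduct]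
  rw [aux_symm hQ x v, dotProduct_comm r v]
  ring

/-- coordinatewise first-order conditions -/
lemma aux_opt {n : ℕ} {l u : Fin n → EReal}
    {Q : Matrix (Fin n) (Fin n) ℝ} (hQ : Q.IsSymm) (r : Fin n → ℝ) (γ : ℝ)
    {x x' : Fin n → ℝ} (hx' : inBox l u x')
    (h : ∀ z, inBox l u z → qf Q r x' + γ / 2 * vnorm (x' - x) ^ 2 ≤
        qf Q r z + γ / 2 * vnorm (z - x) ^ 2) (j : Fin n) (t : ℝ)
    (h1 : l j ≤ ((x' j + t : ℝ) : EReal)) (h2 : ((x' j + t : ℝ) : EReal) ≤ u j) :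
    0 ≤ t * ((Q *ᵥ x' + r + γ • (x' - x)) j) + t ^ 2 * ((Q j j + γ) / 2) := by
  have hz : inBox l u (x' + Pi.single j t) := by
    intro i
    by_cases hi : i = j
    · subst hi; simpa using ⟨h1, h2⟩
    · simpa [hi] using hx' i
  have := h _ hz
  rw [aux_qf hQ, aux_vnorm, aux_vnorm] at this
  have e : x' + Pi.single j t - x = (x' - x) + Pi.single j t := by abel
  rw [e] at this
  simp only [dotProduct_add, add_dotProduct, single_dotProduct, dotProduct_single,
    Matrix.mulVec_single, Pi.single_eq_same] at this
  simp [smul_eq_mul] at this ⊢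
  linarith

lemma aux_small {g c δ : ℝ} (hδ : 0 < δ) (h : ∀ t, 0 ≤ t → t ≤ δ → 0 ≤ t * g + t ^ 2 * c) :
    0 ≤ g := by
  by_contra hg
  push Not at hg
  have hc : 0 < |c| + 1 := by positivity
  have hp : 0 < -g / (|c| + 1) := div_pos (by linarith) hc
  set t := min δ (-g / (|c| + 1) / 2) with ht
  have htp : 0 < t := lt_min hδ (by positivity)
  have h1 := h t htp.le (min_le_left _ _)
  have h2 : t * (|c| + 1) < -g := by
    rw [← lt_div_iff₀ hc]
    have : t ≤ -g / (|c| + 1) / 2 := min_le_right _ _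
    linarith
  have h3 : t * c ≤ t * (|c| + 1) := by
    have := le_abs_self c
    gcongr; linarith
  have : t * (g + t * c) < 0 := mul_neg_of_pos_of_neg htp (by linarith)
  nlinarith

lemma aux_lower {n : ℕ} {l u : Fin n → EReal}
    {Q : Matrix (Fin n) (Fin n) ℝ} (hQ : Q.IsSymm) (r : Fin n → ℝ) (γ : ℝ)
    {x x' : Fin n → ℝ} (hx' : inBox l u x')
    (h : ∀ z, inBox l u z → qf Q r x' + γ / 2 * vnorm (x' - x) ^ 2 ≤
        qf Q r z + γ / 2 * vnorm (z - x) ^ 2) (j : Fin n)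
    (hg : 0 < (Q *ᵥ x' + r + γ • (x' - x)) j) : x' j = (l j).toReal := by
  have : l j = (x' j : EReal) := by
    by_contra hne
    obtain ⟨m, hm1, hm2⟩ := EReal.lt_iff_exists_real_btwn.1 (lt_of_le_of_ne (hx' j).1 hne)
    have hm3 : m < x' j := by exact_mod_cast hm2
    have := aux_small (g := -(Q *ᵥ x' + r + γ • (x' - x)) j) (c := (Q j j + γ) / 2)
      (δ := x' j - m) (by linarith) (fun t ht0 ht => by
        have := aux_opt hQ r γ hx' h j (-t)
          (hm1.le.trans (by exact_mod_cast (by linarith : m ≤ x' j + -t)))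
          (le_trans (by exact_mod_cast (by linarith : x' j + -t ≤ x' j)) (hx' j).2)
        linarith)
    linarith
  rw [this]; simp

lemma aux_upper {n : ℕ} {l u : Fin n → EReal}
    {Q : Matrix (Fin n) (Fin n) ℝ} (hQ : Q.IsSymm) (r : Fin n → ℝ) (γ : ℝ)
    {x x' : Fin n → ℝ} (hx' : inBox l u x')
    (h : ∀ z, inBox l u z → qf Q r x' + γ / 2 * vnorm (x' - x) ^ 2 ≤
        qf Q r z + γ / 2 * vnorm (z - x) ^ 2) (j : Fin n)
    (hg : (Q *ᵥ x' + r + γ • (x' - x)) j < 0) : x' j = (u j).toReal := by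
  have : (x' j : EReal) = u j := by
    by_contra hne
    obtain ⟨m, hm1, hm2⟩ := EReal.lt_iff_exists_real_btwn.1 (lt_of_le_of_ne (hx' j).2 hne)
    have hm3 : x' j < m := by exact_mod_cast hm1
    have := aux_small (g := (Q *ᵥ x' + r + γ • (x' - x)) j) (c := (Q j j + γ) / 2)
      (δ := m - x' j) (by linarith) (fun t ht0 ht => 
        aux_opt hQ r γ hx' h j t
          (le_trans (hx' j).1 (by exact_mod_cast (by linarith : x' j ≤ x' j + t)))
          (le_trans (by exact_mod_cast (by linarith : x' j + t ≤ m)) hm2.le))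
    linarith
  rw [← this]; simp

lemma aux_bddinv {n : ℕ} (A : (Fin n → ℝ) →ₗ[ℝ] (Fin n → ℝ)) :
    ∃ C : ℝ, 0 ≤ C ∧ ∀ w ∈ LinearMap.range A, ∃ h, A h = w ∧ ‖h‖ ≤ C * ‖w‖ := by
  obtain ⟨g, hg⟩ := A.rangeRestrict.exists_rightInverse_of_surjective A.range_rangeRestrict
  refine ⟨‖LinearMap.toContinuousLinearMap g‖, ContinuousLinearMap.opNorm_nonneg _, fun w hw => ⟨g ⟨w, hw⟩, ?_, ?_⟩⟩
  · have := LinearMap.congr_fun hg ⟨w, hw⟩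
    simpa using congrArg Subtype.val this
  · exact (LinearMap.toContinuousLinearMap g).le_opNorm ⟨w, hw⟩

/-- the linear system attached to a sign pattern -/
noncomputable def auxA {n : ℕ} (Q : Matrix (Fin n) (Fin n) ℝ) (s : Fin n → SignType) :
    (Fin n → ℝ) →ₗ[ℝ] (Fin n → ℝ) where
  toFun v j := if s j = 0 then (Q *ᵥ v) j else v j
  map_add' a b := by
    ext j; by_cases h : s j = 0 <;> simp [h, mulVec_add]
  map_smul' a b := by
    ext j; by_cases h : s j = 0 <;> simp [h, mulVec_smul]

noncomputable def auxc {n : ℕ} (l u : Fin n → EReal) (r : Fin n → ℝ) (s : Fin n → SignType) :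
    Fin n → ℝ :=
  fun j => if s j = 0 then - r j else if s j = 1 then (l j).toReal else (u j).toReal

noncomputable def auxs {n : ℕ} (Q : Matrix (Fin n) (Fin n) ℝ) (r : Fin n → ℝ) (γ : ℝ)
    (x x' : Fin n → ℝ) : Fin n → SignType :=
  fun j => SignType.sign ((Q *ᵥ x' + r + γ • (x' - x)) j)

noncomputable def auxe {n : ℕ} (γ : ℝ) (x x' : Fin n → ℝ) (s : Fin n → SignType) : Fin n → ℝ :=
  fun j => if s j = 0 then - (γ * (x' j - x j)) else 0

lemma aux_sys {n : ℕ} {l u : Fin n → EReal}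
    {Q : Matrix (Fin n) (Fin n) ℝ} (hQ : Q.IsSymm) (r : Fin n → ℝ) (γ : ℝ)
    {x x' : Fin n → ℝ} (hx' : inBox l u x')
    (h : ∀ z, inBox l u z → qf Q r x' + γ / 2 * vnorm (x' - x) ^ 2 ≤
        qf Q r z + γ / 2 * vnorm (z - x) ^ 2) (s : Fin n → SignType)
    (hs : auxs Q r γ x x' = s) : auxA Q s x' = auxc l u r s + auxe γ x x' s := by
  ext j
  have hsj : SignType.sign ((Q *ᵥ x' + r + γ • (x' - x)) j) = s j := congrFun hs j
  rcases lt_trichotomy ((Q *ᵥ x' + r + γ • (x' - x)) j) 0 with hg | hg | hg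
  · have h1 := aux_upper hQ r γ hx' h j hg
    rw [sign_neg hg] at hsj
    simp [auxA, auxc, auxe, ← hsj, h1]
  · rw [hg, sign_zero] at hsj
    simp [auxA, auxc, auxe, ← hsj] at hg ⊢
    linarith
  · have h1 := aux_lower hQ r γ hx' h j hg
    rw [sign_pos hg] at hsj
    simp [auxA, auxc, auxe, ← hsj, h1]

lemma auxe_norm {n : ℕ} {γ : ℝ} (hγ : 0 < γ) (x x' : Fin n → ℝ) (s : Fin n → SignType) :
    ‖auxe γ x x' s‖ ≤ γ * ‖x' - x‖ := by
  rw [pi_norm_le_iff_of_nonneg (by positivity)]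
  intro j
  unfold auxe
  split_ifs
  · rw [norm_neg, norm_mul, Real.norm_of_nonneg hγ.le]
    gcongr
    exact norm_le_pi_norm (x' - x) j
  · simp; positivity

/-- value estimate -/
lemma aux_val {n : ℕ} {l u : Fin n → EReal}
    {Q : Matrix (Fin n) (Fin n) ℝ} (hQ : Q.IsSymm) (r : Fin n → ℝ) {γ : ℝ} (hγ : 0 < γ)
    (s : Fin n → SignType) (x0 : Fin n → ℝ) (hx0 : auxA Q s x0 = auxc l u r s) :
    ∃ C : ℝ, 0 ≤ C ∧ ∀ x x' : Fin n → ℝ, auxA Q s x' = auxc l u r s + auxe γ x x' s →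
      |qf Q r x' - qf Q r x0| ≤ C * ‖x' - x‖ ^ 2 := by
  obtain ⟨C, hC, hinv⟩ := aux_bddinv (auxA Q s)
  refine ⟨n * C * γ ^ 2, by positivity, fun x x' h => ?_⟩
  set e := auxe γ x x' s with he
  set v := x' - x0 with hv
  have hAv : auxA Q s v = e := by rw [hv, map_sub, h, hx0]; simp
  obtain ⟨w, hw, hwn⟩ := hinv e ⟨v, hAv⟩
  have key : ∀ a b : Fin n → ℝ, auxA Q s a = e → auxA Q s b = e → a ⬝ᵥ e = a ⬝ᵥ Q *ᵥ b := by
    intro a b ha hb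
    unfold dotProduct
    refine Finset.sum_congr rfl fun j _ => ?_
    have ha := congrFun ha j
    have hb := congrFun hb j
    by_cases hs : s j = 0
    · simp [auxA, hs] at hb; rw [hb]
    · have h0 : e j = 0 := by simp [he, auxe, hs]
      simp [auxA, hs] at ha; rw [ha, h0]; simp
  have h1 : v ⬝ᵥ e = w ⬝ᵥ e := by
    rw [key v w hAv hw, aux_symm hQ, ← key w v hw hAv]
  have h2 : v ⬝ᵥ (Q *ᵥ x0 + r) = 0 := by
    unfold dotProduct
    refine Finset.sum_eq_zero fun j _ => ?_
    have ha := congrFun hAv j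
    have hb := congrFun hx0 j
    by_cases hs : s j = 0
    · simp [auxA, auxc, hs] at hb; simp [hb]
    · have h0 : e j = 0 := by simp [he, auxe, hs]
      simp [auxA, hs] at ha; rw [ha, h0]; simp
  have h3 : qf Q r x' - qf Q r x0 = 1 / 2 * (w ⬝ᵥ e) := by
    have : x' = x0 + v := by simp [hv]
    rw [this, aux_qf hQ, h2, ← key v v hAv hAv, h1]; ring
  have hen : ‖e‖ ≤ γ * ‖x' - x‖ := auxe_norm hγ x x' s
  rw [h3, abs_mul, abs_of_pos (by norm_num : (0:ℝ) < 1 / 2)]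
  have h4 := aux_dot_le w e
  have h5 : ‖w‖ * ‖e‖ ≤ C * γ ^ 2 * ‖x' - x‖ ^ 2 := by
    calc ‖w‖ * ‖e‖ ≤ (C * ‖e‖) * ‖e‖ := by gcongr
      _ = C * (‖e‖ * ‖e‖) := by ring
      _ ≤ C * ((γ * ‖x' - x‖) * (γ * ‖x' - x‖)) := by gcongr
      _ = _ := by ring
  have h6 : (n : ℝ) * (‖w‖ * ‖e‖) ≤ n * (C * γ ^ 2 * ‖x' - x‖ ^ 2) := by gcongr
  have h7 := abs_nonneg (w ⬝ᵥ e)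
  linarith

/-- PPA sequences are bounded. -/
lemma aux_bounded {n : ℕ} (l u : Fin n → EReal)
    (Q : Matrix (Fin n) (Fin n) ℝ) (hQ : Q.IsSymm) (r : Fin n → ℝ)
    (γ : ℝ) (hγ : 0 < γ)
    (hbdd : ∃ B : ℝ, ∀ z, inBox l u z → B ≤ qf Q r z)
    (x : ℕ → Fin n → ℝ) (hmem : ∀ k, inBox l u (x k))
    (hppa : ∀ k, ∀ z, inBox l u z →
      qf Q r (x (k + 1)) + γ / 2 * vnorm (x (k + 1) - x k) ^ 2 ≤
        qf Q r z + γ / 2 * vnorm (z - x k) ^ 2) :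
    CauchySeq x := by
  obtain ⟨B, hB⟩ := hbdd
  set f : ℕ → ℝ := fun k => qf Q r (x k) with hf
  have hdesc : ∀ k, f (k + 1) + γ / 2 * ‖x (k + 1) - x k‖ ^ 2 ≤ f k := by
    intro k
    have h := hppa k (x k) (hmem k)
    rw [aux_vnorm, aux_vnorm] at h
    simp only [sub_self, zero_dotProduct, mul_zero, add_zero] at h
    have h2 : γ / 2 * ‖x (k + 1) - x k‖ ^ 2 ≤ γ / 2 * ((x (k+1) - x k) ⬝ᵥ (x (k+1) - x k)) := by
      gcongr; exact aux_norm_le _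
    simp only [hf]; linarith
  have hanti : Antitone f := antitone_nat_of_succ_le fun k => by
    have := hdesc k
    have : 0 ≤ γ / 2 * ‖x (k + 1) - x k‖ ^ 2 := by positivity
    linarith
  have hbb : BddBelow (Set.range f) := ⟨B, by rintro _ ⟨k, rfl⟩; exact hB _ (hmem k)⟩
  obtain ⟨L, hL⟩ : ∃ L, Tendsto f atTop (𝓝 L) := ⟨_, tendsto_atTop_ciInf hanti hbb⟩
  have hLle : ∀ k, L ≤ f k := fun k => hanti.le_of_tendsto hL k
  have hL1 : Tendsto (fun k => f (k + 1)) atTop (𝓝 L) := (tendsto_add_atTop_iff_nat 1).2 hL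
  have hD : Tendsto (fun k => ‖x (k + 1) - x k‖ ^ 2) atTop (𝓝 0) := by
    have h1 : Tendsto (fun k => 2 / γ * (f k - f (k + 1))) atTop (𝓝 0) := by
      simpa using (hL.sub hL1).const_mul (2 / γ)
    refine squeeze_zero (fun k => by positivity) (fun k => ?_) h1
    have := hdesc k
    rw [div_mul_eq_mul_div, le_div_iff₀ hγ]
    linarith
  have hD1 : Tendsto (fun k => ‖x (k + 1) - x k‖) atTop (𝓝 0) := by
    have := hD.sqrt
    simpa [Real.sqrt_sq] using this
  have hpat : ∀ s : Fin n → SignType, ∃ C : ℝ, 0 ≤ C ∧ ∀ᶠ k in atTop,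
      auxs Q r γ (x k) (x (k + 1)) = s → f (k + 1) - L ≤ C * ‖x (k + 1) - x k‖ ^ 2 := by
    intro s
    by_cases hfr : ∃ᶠ k in atTop, auxs Q r γ (x k) (x (k + 1)) = s
    · obtain ⟨ψ, hψ, hψs⟩ := extraction_of_frequently_atTop hfr
      have hψt := hψ.tendsto_atTop
      have hsys : ∀ k, auxs Q r γ (x k) (x (k + 1)) = s →
          auxA Q s (x (k+1)) = auxc l u r s + auxe γ (x k) (x (k+1)) s := fun k hk =>
        aux_sys hQ r γ (hmem (k+1)) (hppa k) s hk
      have he0 : Tendsto (fun k => auxe γ (x k) (x (k+1)) s) atTop (𝓝 0) := by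
        refine squeeze_zero_norm (fun k => auxe_norm hγ _ _ _) ?_
        simpa using hD1.const_mul γ
      have hc : auxc l u r s ∈ LinearMap.range (auxA Q s) := by
        have hcl : IsClosed (LinearMap.range (auxA Q s) : Set (Fin n → ℝ)) :=
          Submodule.closed_of_finiteDimensional _
        have ht : Tendsto (fun i => auxc l u r s + auxe γ (x (ψ i)) (x (ψ i + 1)) s) atTop
            (𝓝 (auxc l u r s)) := by
          simpa using (he0.comp hψt).const_add (auxc l u r s)
        refine hcl.mem_of_tendsto ht (Eventually.of_forall fun i => ?_)
        exact ⟨x (ψ i + 1), hsys _ (hψs i)⟩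
      obtain ⟨x0, hx0⟩ := hc
      obtain ⟨C, hC, hval⟩ := aux_val hQ r hγ s x0 hx0
      have hq : qf Q r x0 = L := by
        have h1 : Tendsto (fun i => f (ψ i + 1) - qf Q r x0) atTop (𝓝 0) := by
          refine squeeze_zero_norm (fun i => hval _ _ (hsys _ (hψs i))) ?_
          simpa using (hD.comp hψt).const_mul C
        have h2 : Tendsto (fun i => f (ψ i + 1) - qf Q r x0) atTop (𝓝 (L - qf Q r x0)) :=
          (hL1.comp hψt).sub_const _
        have := tendsto_nhds_unique h1 h2
        linarith
      refine ⟨C, hC, Eventually.of_forall fun k hk => ?_⟩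
      have := hval _ _ (hsys k hk)
      rw [hq] at this
      exact (le_abs_self _).trans this
    · refine ⟨0, le_rfl, ?_⟩
      rw [not_frequently] at hfr
      filter_upwards [hfr] with k hk h
      exact absurd h hk
  choose C hC0 hC using hpat
  have hall : ∀ᶠ k in atTop, f (k + 1) - L ≤ (∑ s, C s) * ‖x (k + 1) - x k‖ ^ 2 := by
    filter_upwards [eventually_all.2 hC] with k hk
    refine (hk _ rfl).trans ?_
    gcongr
    exact Finset.single_le_sum (f := C) (fun s _ => hC0 s) (Finset.mem_univ _)
  obtain ⟨N, hN⟩ := eventually_atTop.1 hall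
  set S := ∑ s, C s with hS
  have hS0 : 0 ≤ S := Finset.sum_nonneg fun s _ => hC0 s
  -- geometric decay
  set ρ : ℝ := S / (S + γ / 2) with hρ
  have hρ0 : 0 ≤ ρ := by positivity
  have hρ1 : ρ < 1 := by rw [hρ, div_lt_one (by positivity)]; linarith
  have hstep : ∀ k, N ≤ k → f (k + 1) - L ≤ ρ * (f k - L) := by
    intro k hk
    have h1 := hN k hk
    have h2 := hdesc k
    rw [hρ, div_mul_eq_mul_div, le_div_iff₀ (by positivity)]
    nlinarith [mul_le_mul_of_nonneg_left h2 hS0]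
  have hgeo : ∀ m, f (m + N) - L ≤ (f N - L) * ρ ^ m := by
    intro m
    induction m with
    | zero => simp
    | succ m ih =>
      have h1 := hstep (m + N) (by omega)
      have h2 := mul_le_mul_of_nonneg_left ih hρ0
      have h3 : m + 1 + N = m + N + 1 := by omega
      rw [h3, pow_succ]
      linarith
  have hcs : CauchySeq (fun m => x (m + N)) := by
    refine cauchySeq_of_le_geometric (Real.sqrt ρ) (Real.sqrt (2 / γ * (f N - L)))
      (by rw [Real.sqrt_lt' one_pos]; simpa using hρ1) (fun m => ?_)
    rw [dist_comm, dist_eq_norm, show m + 1 + N = m + N + 1 by omega]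
    have hn0 : 0 ≤ 2 / γ * (f N - L) := mul_nonneg (by positivity) (by linarith [hLle N])
    refine (pow_le_pow_iff_left₀ (norm_nonneg _) (by positivity) two_ne_zero).1 ?_
    rw [mul_pow, ← pow_mul, mul_comm m 2, pow_mul, Real.sq_sqrt hn0, Real.sq_sqrt hρ0]
    have h1 := hdesc (m + N)
    have h2 := hLle (m + N + 1)
    have h3 := hgeo m
    rw [mul_assoc, div_mul_eq_mul_div, le_div_iff₀ hγ]
    linarith
  exact (cauchySeq_shift N).1 hcs

lemma aux_bar {n : ℕ} {l u : Fin n → EReal} (hl : ∀ j, l j ≠ ⊤) (hu : ∀ j, u j ≠ ⊥)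
    {y : Fin n → ℝ} (hy : inOmegaBar l u y) :
    ‖y‖ ≤ ‖fun j => |(l j).toReal| + |(u j).toReal|‖ := by
  rw [pi_norm_le_iff_of_nonneg (norm_nonneg _)]
  intro j
  refine le_trans ?_ (norm_le_pi_norm _ j)
  rw [Real.norm_eq_abs, Real.norm_of_nonneg (by positivity)]
  obtain ⟨h1, h2, h3, h4⟩ := hy j
  have a1 := abs_nonneg (l j).toReal
  have a2 := abs_nonneg (u j).toReal
  by_cases hlj : l j = ⊥ <;> by_cases huj : u j = ⊤
  · rw [h3 ⟨hlj, huj⟩, abs_zero]; positivity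
  · rw [← h2 ⟨hlj, huj⟩]; simp
  · rw [← h1 ⟨hlj, huj⟩]; simp
  · obtain ⟨h5, h6⟩ := h4 ⟨hlj, huj⟩
    rw [← EReal.coe_toReal (hl j) hlj] at h5
    rw [← EReal.coe_toReal huj (hu j)] at h6
    have h5 : (l j).toReal ≤ y j := by exact_mod_cast h5
    have h6 : y j ≤ (u j).toReal := by exact_mod_cast h6
    rw [abs_le]
    constructor
    · linarith [neg_abs_le (l j).toReal]
    · linarith [le_abs_self (u j).toReal]

/-- Theorem 3.4: if `d ∈ Ω₁^∞` is a limit of directions `d^{k_i}` of the recession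
decomposition along a subsequence with `α^{k_i} → ∞`, then there exists `ε_d > 0`
such that `dist(d^k, d) ≤ ε_d` implies `α^k dᵀd^k ≤ α^{k−1} dᵀd^{k−1}`. -/
theorem ppa_recession_coefficient_noincrease {n : ℕ} (hn : 1 ≤ n)
    (l u : Fin n → EReal)
    (hl : ∀ j, l j ≠ ⊤) (hu : ∀ j, u j ≠ ⊥) (hlu : ∀ j, l j < u j)
    (Q : Matrix (Fin n) (Fin n) ℝ) (hQ : Q.IsSymm) (r : Fin n → ℝ)
    (γ : ℝ) (hγ : 0 < γ)
    (hpd : (Q + γ • (1 : Matrix (Fin n) (Fin n) ℝ)).PosDef)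
    (hbdd : ∃ B : ℝ, ∀ z, inBox l u z → B ≤ qf Q r z)
    (x : ℕ → Fin n → ℝ) (hmem : ∀ k, inBox l u (x k))
    (hppa : ∀ k, ∀ z, inBox l u z →
      qf Q r (x (k + 1)) + γ / 2 * vnorm (x (k + 1) - x k) ^ 2 ≤
        qf Q r z + γ / 2 * vnorm (z - x k) ^ 2)
    (y : ℕ → Fin n → ℝ) (α : ℕ → ℝ) (dd : ℕ → Fin n → ℝ)
    (hy : ∀ k, inOmegaBar l u (y k)) (hα : ∀ k, 0 ≤ α k)
    (hdd : ∀ k, recDir l u (dd k)) (hdd1 : ∀ k, vnorm (dd k) = 1)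
    (hdecomp : ∀ k, x k = y k + α k • dd k)
    (d : Fin n → ℝ) (hd : recDir l u d) (hd1 : vnorm d = 1)
    (φ : ℕ → ℕ) (hφ : StrictMono φ)
    (hαφ : Tendsto (fun i => α (φ i)) atTop atTop)
    (hdφ : Tendsto (fun i => dd (φ i)) atTop (𝓝 d)) :
    ∃ ε : ℝ, 0 < ε ∧ ∀ k : ℕ, 1 ≤ k → Real.arccos (d ⬝ᵥ dd k) ≤ ε →
      α k * (d ⬝ᵥ dd k) ≤ α (k - 1) * (d ⬝ᵥ dd (k - 1)) := by
  exfalso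
  have hc := aux_bounded l u Q hQ r γ hγ hbdd x hmem hppa
  obtain ⟨xs, hxs⟩ := cauchySeq_tendsto_of_complete hc
  obtain ⟨M, hM⟩ := hxs.norm.bddAbove_range
  set R := ‖fun j => |(l j).toReal| + |(u j).toReal|‖ with hR
  have hbound : ∀ k, α k ≤ n * (M + R) := by
    intro k
    have h1 : x k - y k = α k • dd k := by rw [hdecomp k]; simp
    have h2 : ‖x k - y k‖ ≤ M + R :=
      (norm_sub_le _ _).trans (add_le_add (hM ⟨k, rfl⟩) (aux_bar hl hu (hy k)))
    have h3 : dd k ⬝ᵥ dd k = 1 := by rw [← aux_vnorm, hdd1 k]; norm_num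
    have h4 : dd k ⬝ᵥ (x k - y k) = α k := by rw [h1, dotProduct_smul, h3]; simp
    have h5 := aux_dot_le (dd k) (x k - y k)
    rw [h4] at h5
    have h6 : ‖dd k‖ ≤ 1 := by
      have := aux_norm_le (dd k)
      rw [h3] at this
      nlinarith [norm_nonneg (dd k)]
    have h7 : ‖dd k‖ * ‖x k - y k‖ ≤ 1 * (M + R) := by gcongr
    have h8 : (n : ℝ) * (‖dd k‖ * ‖x k - y k‖) ≤ n * (1 * (M + R)) := by gcongr
    have := le_abs_self (α k)
    linarith
  obtain ⟨i, hi⟩ := (hαφ.eventually_gt_atTop (n * (M + R))).exists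
  linarith [hbound (φ i)]
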